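/- Let u_1, …, u_n ∈ ℂ^m be nonzero vectors, p ∈ ℝ^n_{≥0}, and let Q be an m×m positive-definite Hermitian matrix with nonincreasing eigenvalues q_1 ≥ … ≥ q_m > 0. Then (u_1, …, u_n) can be approximately put in Q-isotropic position with respect to p if and only if p ∈ K_q(U), where K_q(U) is the convex hull of the vectors v^{S,σ} ∈ ℝ^n, over all subsets S ⊆ [n] of size m such that {u_i : i ∈ S} is a basis of ℂ^m and all bijections σ : S → [m], defined by v^{S,σ}_i = q_{σ(i)} if i ∈ S and v^{S,σ}_i = 0 otherwise. -/

import Mathlib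

open Matrix BigOperators

noncomputable section

/-- `η_j` : the projection onto the first `j` coordinates, as a `j × k` matrix. -/
def proj (j k : ℕ) : Matrix (Fin j) (Fin k) ℂ :=
  Matrix.of fun i l => if (i : ℕ) = (l : ℕ) then 1 else 0

/-- `Δa_j = a_j − a_{j+1}`, with the convention `a_{k+1} = 0`. -/
def delta {k : ℕ} (a : Fin k → ℝ) (j : Fin k) : ℝ :=
  a j - (if h : (j : ℕ) + 1 < k then a ⟨(j : ℕ) + 1, h⟩ else 0)

/-- Integer version of `delta`. -/
def deltaNat {k : ℕ} (a : Fin k → ℕ) (j : Fin k) : ℕ :=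
  a j - (if h : (j : ℕ) + 1 < k then a ⟨(j : ℕ) + 1, h⟩ else 0)

/-- The relative determinant `det(diag a, X) = ∏_j det(η_j X η_j†)^{Δa_j}` (real exponents,
with the convention `0 ^ 0 = 1`). -/
def relDet {k : ℕ} (a : Fin k → ℝ) (X : Matrix (Fin k) (Fin k) ℂ) : ℝ :=
  ∏ j : Fin k,
    ((proj ((j : ℕ) + 1) k * X * (proj ((j : ℕ) + 1) k)ᴴ).det.re) ^ (delta a j)

/-- Complex relative determinant for integral weights. -/
def relDetC {k : ℕ} (a : Fin k → ℕ) (X : Matrix (Fin k) (Fin k) ℂ) : ℂ :=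
  ∏ j : Fin k,
    ((proj ((j : ℕ) + 1) k * X * (proj ((j : ℕ) + 1) k)ᴴ).det) ^ (deltaNat a j)

/-- The completely positive map `T(X) = Σ A_i X A_i†` with Kraus operators `A i`. -/
def cpMap {ι κ : Type*} [Fintype ι] {r : ℕ} (A : Fin r → Matrix κ ι ℂ)
    (X : Matrix ι ι ℂ) : Matrix κ κ ℂ :=
  ∑ i, A i * X * (A i)ᴴ

/-- The dual completely positive map `T*(Y) = Σ A_i† Y A_i`. -/
def cpDual {ι κ : Type*} [Fintype κ] {r : ℕ} (A : Fin r → Matrix κ ι ℂ)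
    (Y : Matrix κ κ ℂ) : Matrix ι ι ℂ :=
  ∑ i, (A i)ᴴ * Y * A i

/-- Frobenius norm `‖A‖ = √(Tr A Aᴴ)`. -/
def frob {ι κ : Type*} [Fintype ι] [Fintype κ] (A : Matrix ι κ ℂ) : ℝ :=
  Real.sqrt (A * Aᴴ).trace.re

/-- Upper triangular predicate. -/
def UT {k : ℕ} (g : Matrix (Fin k) (Fin k) ℂ) : Prop :=
  ∀ i j : Fin k, j < i → g i j = 0

/-- Capacity with specified marginals:
`cap(T,P,Q) = inf over invertible upper triangular h of det(Q, T(hPh†)) / det(P, h†h)`. -/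
def cap {n m r : ℕ} (A : Fin r → Matrix (Fin m) (Fin n) ℂ)
    (p : Fin n → ℝ) (q : Fin m → ℝ) : ℝ :=
  sInf { x : ℝ | ∃ h : Matrix (Fin n) (Fin n) ℂ, IsUnit h.det ∧ UT h ∧
    x = relDet q (cpMap A (h * Matrix.diagonal (fun j => (p j : ℂ)) * hᴴ)) /
        relDet p (hᴴ * h) }

/-- Span of the first `i` standard basis vectors of `ℂ^k`. -/
def coordSub (k i : ℕ) : Submodule ℂ (Fin k → ℂ) where
  carrier := { x | ∀ l : Fin k, i ≤ (l : ℕ) → x l = 0 }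
  add_mem' := by intro a b ha hb l hl; simp [ha l hl, hb l hl]
  zero_mem' := by intro l _; rfl
  smul_mem' := by intro c x hx l hl; simp [hx l hl]

/-- `(L, R)` is a `T`-independent pair: `A_i R ⊥ L` for all `i`. -/
def TIndep {n m r : ℕ} (A : Fin r → Matrix (Fin m) (Fin n) ℂ)
    (L : Submodule ℂ (Fin m → ℂ)) (R : Submodule ℂ (Fin n → ℂ)) : Prop :=
  ∀ i : Fin r, ∀ x ∈ R, ∀ y ∈ L, star y ⬝ᵥ (A i).mulVec x = 0

/-- `(P,Q)`-rank-nondecreasingness. -/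
def rankNonDec {n m r : ℕ} (A : Fin r → Matrix (Fin m) (Fin n) ℂ)
    (p : Fin n → ℝ) (q : Fin m → ℝ) : Prop :=
  ∀ L : Submodule ℂ (Fin m → ℂ), ∀ R : Submodule ℂ (Fin n → ℂ), TIndep A L R →
    (∑ i : Fin m, delta q i * (Module.finrank ℂ ↥(coordSub m ((i : ℕ) + 1) ⊓ L) : ℝ)) +
      (∑ j : Fin n, delta p j * (Module.finrank ℂ ↥(coordSub n ((j : ℕ) + 1) ⊓ R) : ℝ))
      ≤ ∑ j, p j

/-- `λ'_{i+1}`: number of parts of `lam` that are `> i` (0-indexed conjugate partition). -/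
def conj' {k : ℕ} (lam : Fin k → ℕ) (i : ℕ) : ℕ :=
  (Finset.univ.filter fun j : Fin k => i < lam j).card

lemma conj'_le {k : ℕ} (lam : Fin k → ℕ) (i : ℕ) : conj' lam i ≤ k := by
  classical
  calc conj' lam i ≤ Finset.univ.card := Finset.card_filter_le _ _
    _ = k := by simp

/-- Index set for the blocks of `G_λ`; it has cardinality `Σ_i λ'_i = Σ_j λ_j`. -/
abbrev lamIdx {k : ℕ} (lam : Fin k → ℕ) : Type :=
  Σ i : Fin (Finset.univ.sup lam), Fin (conj' lam (i : ℕ))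

/-- The gadget map `G_λ(X) = ⊕_{i=1}^{λ_1} η_{λ'_i} X η_{λ'_i}†`. -/
def Gmap {k : ℕ} (lam : Fin k → ℕ) (X : Matrix (Fin k) (Fin k) ℂ) :
    Matrix (lamIdx lam) (lamIdx lam) ℂ := fun s t =>
  if s.1 = t.1 then
    X (Fin.castLE (conj'_le lam (s.1 : ℕ)) s.2) (Fin.castLE (conj'_le lam (t.1 : ℕ)) t.2)
  else 0

/-- The adjoint `G_λ*` of the gadget map with respect to the trace inner product. -/
def GmapAdj {k : ℕ} (lam : Fin k → ℕ) (Y : Matrix (lamIdx lam) (lamIdx lam) ℂ) :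
    Matrix (Fin k) (Fin k) ℂ := fun a b =>
  ∑ i : Fin (Finset.univ.sup lam),
    if h : (a : ℕ) < conj' lam (i : ℕ) ∧ (b : ℕ) < conj' lam (i : ℕ) then
      Y ⟨i, ⟨(a : ℕ), h.1⟩⟩ ⟨i, ⟨(b : ℕ), h.2⟩⟩
    else 0

/-- The reduction `trun_{P,Q} T = G_q ∘ T ∘ G_p*`. -/
def trun {n m r : ℕ} (A : Fin r → Matrix (Fin m) (Fin n) ℂ) (p : Fin n → ℕ) (q : Fin m → ℕ)
    (X : Matrix (lamIdx p) (lamIdx p) ℂ) : Matrix (lamIdx q) (lamIdx q) ℂ :=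
  Gmap q (cpMap A (GmapAdj p X))

/-- The dual of the reduction: `(trun_{P,Q} T)* = G_p ∘ T* ∘ G_q*`. -/
def trunDual {n m r : ℕ} (A : Fin r → Matrix (Fin m) (Fin n) ℂ) (p : Fin n → ℕ) (q : Fin m → ℕ)
    (Y : Matrix (lamIdx q) (lamIdx q) ℂ) : Matrix (lamIdx p) (lamIdx p) ℂ :=
  Gmap p (cpDual A (GmapAdj q Y))

/-- Shannon entropy with convention `0 · log 0 = 0` (note `Real.log 0 = 0`). -/
def entropy {k : ℕ} (p : Fin k → ℝ) : ℝ := -∑ j, p j * Real.log (p j)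

/-- The distance-to-target measure `ds_{P,Q}(T)`. -/
def ds {n m r : ℕ} (A : Fin r → Matrix (Fin m) (Fin n) ℂ)
    (p : Fin n → ℝ) (q : Fin m → ℝ) : ℝ :=
  (∑ j : Fin n, delta p j *
      (frob (proj ((j : ℕ) + 1) n *
        (cpDual A (Matrix.diagonal fun i => (q i : ℂ)) - 1) * (proj ((j : ℕ) + 1) n)ᴴ)) ^ 2) +
    ∑ i : Fin m, delta q i *
      (frob (proj ((i : ℕ) + 1) m *
        (cpMap A (Matrix.diagonal fun j => (p j : ℂ)) - 1) * (proj ((i : ℕ) + 1) m)ᴴ)) ^ 2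

/-- `(u_1,…,u_n)` can be approximately put in `Q`-isotropic position with respect to `p`. -/
def approxIso {m n : ℕ} (u : Fin n → Fin m → ℂ) (p : Fin n → ℝ)
    (Q : Matrix (Fin m) (Fin m) ℂ) : Prop :=
  ∀ ε : ℝ, 0 < ε → ∃ B : Matrix (Fin m) (Fin m) ℂ, IsUnit B.det ∧
    frob ((∑ i : Fin n,
      (((p i / ∑ a, Complex.normSq (B.mulVec (u i) a)) : ℝ) : ℂ) •
        Matrix.vecMulVec (B.mulVec (u i)) (star (B.mulVec (u i)))) - Q) ≤ ε

/-- The squared Euclidean norm of a complex vector. -/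
def sqNorm {m : ℕ} (x : Fin m → ℂ) : ℝ := ∑ a, Complex.normSq (x a)

lemma sqNorm_nonneg {m : ℕ} (x : Fin m → ℂ) : 0 ≤ sqNorm x :=
  Finset.sum_nonneg fun _ _ => Complex.normSq_nonneg _

lemma sqNorm_pos {m : ℕ} {x : Fin m → ℂ} (hx : x ≠ 0) : 0 < sqNorm x := by
  obtain ⟨a, ha⟩ := Function.ne_iff.mp hx
  exact Finset.sum_pos' (fun _ _ => Complex.normSq_nonneg _)
    ⟨a, Finset.mem_univ a, Complex.normSq_pos.mpr ha⟩

lemma normSq_le_sqNorm {m : ℕ} (x : Fin m → ℂ) (a : Fin m) :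
    Complex.normSq (x a) ≤ sqNorm x :=
  Finset.single_le_sum (f := fun a => Complex.normSq (x a))
    (fun _ _ => Complex.normSq_nonneg _) (Finset.mem_univ a)

lemma sqNorm_update {m : ℕ} (x : Fin m → ℂ) (a : Fin m) (c : ℂ) :
    sqNorm (Function.update x a c) = sqNorm x + (Complex.normSq c - Complex.normSq (x a)) := by
  unfold sqNorm
  rw [← Finset.add_sum_erase _ _ (Finset.mem_univ a),
    ← Finset.add_sum_erase _ (fun b => Complex.normSq (x b)) (Finset.mem_univ a),
    Finset.sum_congr rfl fun b hb => by
      rw [Function.update_of_ne (Finset.ne_of_mem_erase hb)]]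
  simp only [Function.update_self]
  ring

/-- The weighted frame operator `∑ i, p i • w i (w i)† / ‖w i‖²`. -/
def frameOp {m n : ℕ} (p : Fin n → ℝ) (w : Fin n → Fin m → ℂ) : Matrix (Fin m) (Fin m) ℂ :=
  ∑ i, ((p i / sqNorm (w i) : ℝ) : ℂ) • vecMulVec (w i) (star (w i))

lemma frameOp_apply {m n : ℕ} (p : Fin n → ℝ) (w : Fin n → Fin m → ℂ) (a b : Fin m) :
    frameOp p w a b = ∑ i, ((p i / sqNorm (w i) : ℝ) : ℂ) * (w i a * star (w i b)) := by
  simp [frameOp, Matrix.sum_apply, vecMulVec_apply]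

lemma frameOp_apply_swap {m n : ℕ} (p : Fin n → ℝ) (w : Fin n → Fin m → ℂ) (a b : Fin m) :
    frameOp p w b a = star (frameOp p w a b) := by
  simp only [frameOp_apply, Complex.star_def, map_sum, map_mul, Complex.conj_ofReal,
    Complex.conj_conj]
  exact Finset.sum_congr rfl fun i _ => by ring

lemma frameOp_diag {m n : ℕ} (p : Fin n → ℝ) (w : Fin n → Fin m → ℂ) (a : Fin m) :
    frameOp p w a a = ((∑ i, p i / sqNorm (w i) * Complex.normSq (w i a) : ℝ) : ℂ) := by
  rw [frameOp_apply]
  push_cast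
  exact Finset.sum_congr rfl fun i _ => by rw [Complex.star_def, Complex.mul_conj]

/-- Invertible lower triangular matrices. -/
def LowerInv {m : ℕ} (B : Matrix (Fin m) (Fin m) ℂ) : Prop :=
  (∀ i j, i < j → B i j = 0) ∧ ∀ i, B i i ≠ 0

lemma LowerInv.det_eq {m : ℕ} {B : Matrix (Fin m) (Fin m) ℂ} (hB : LowerInv B) :
    B.det = ∏ i, B i i :=
  det_of_isLowerTriangular B fun i j h => hB.1 i j h

lemma LowerInv.isUnit_det {m : ℕ} {B : Matrix (Fin m) (Fin m) ℂ} (hB : LowerInv B) :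
    IsUnit B.det := by
  rw [hB.det_eq, isUnit_iff_ne_zero]
  exact Finset.prod_ne_zero_iff.mpr fun i _ => hB.2 i

lemma mulVec_ne_zero_of_isUnit_det {m : ℕ} {B : Matrix (Fin m) (Fin m) ℂ} (hB : IsUnit B.det)
    {x : Fin m → ℂ} (hx : x ≠ 0) : B *ᵥ x ≠ 0 := fun h =>
  hx (Matrix.eq_zero_of_mulVec_eq_zero hB.ne_zero h)

/-- The Kempf–Ness type potential on invertible lower triangular matrices whose critical points
put the vectors `y i` in isotropic position with respect to `diag q`. -/
def potential {m n : ℕ} (p : Fin n → ℝ) (q : Fin m → ℝ) (y : Fin n → Fin m → ℂ)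
    (B : Matrix (Fin m) (Fin m) ℂ) : ℝ :=
  ∑ i, p i * Real.log (sqNorm (B *ᵥ y i)) - ∑ j, q j * Real.log (Complex.normSq (B j j))

lemma potential_updateRow_le {m n : ℕ} {p : Fin n → ℝ} (hp : ∀ i, 0 ≤ p i) (q : Fin m → ℝ)
    {y : Fin n → Fin m → ℂ} (hy : ∀ i, y i ≠ 0) {B : Matrix (Fin m) (Fin m) ℂ}
    (hB : LowerInv B) (j : Fin m) (r : Fin m → ℂ) (hB' : LowerInv (B.updateRow j r)) :
    potential p q y (B.updateRow j r) - potential p q y B ≤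
      ∑ i, p i / sqNorm (B *ᵥ y i) *
          (Complex.normSq (r ⬝ᵥ y i) - Complex.normSq ((B *ᵥ y i) j)) -
        q j * (Real.log (Complex.normSq (r j)) - Real.log (Complex.normSq (B j j))) := by
  have h1 : ∑ k, q k * Real.log (Complex.normSq (B.updateRow j r k k)) -
      ∑ k, q k * Real.log (Complex.normSq (B k k)) =
      q j * (Real.log (Complex.normSq (r j)) - Real.log (Complex.normSq (B j j))) := by
    rw [← Finset.sum_sub_distrib, Finset.sum_eq_single j]
    · simp [mul_sub]
    · intro b _ hb
      simp [hb]
    · simp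
  have h2 : ∑ i, p i * Real.log (sqNorm (B.updateRow j r *ᵥ y i)) -
      ∑ i, p i * Real.log (sqNorm (B *ᵥ y i)) ≤
      ∑ i, p i / sqNorm (B *ᵥ y i) *
          (Complex.normSq (r ⬝ᵥ y i) - Complex.normSq ((B *ᵥ y i) j)) := by
    rw [← Finset.sum_sub_distrib]
    refine Finset.sum_le_sum fun i _ => ?_
    have hw := sqNorm_pos (mulVec_ne_zero_of_isUnit_det hB.isUnit_det (hy i))
    have hw' := sqNorm_pos (mulVec_ne_zero_of_isUnit_det hB'.isUnit_det (hy i))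
    have h3 := Real.log_le_sub_one_of_pos (div_pos hw' hw)
    rw [Real.log_div hw'.ne' hw.ne'] at h3
    have h4 : sqNorm (B.updateRow j r *ᵥ y i) = sqNorm (B *ᵥ y i) +
        (Complex.normSq (r ⬝ᵥ y i) - Complex.normSq ((B *ᵥ y i) j)) := by
      rw [Matrix.updateRow_mulVec, sqNorm_update]
    calc _ = p i * (Real.log (sqNorm (B.updateRow j r *ᵥ y i)) -
          Real.log (sqNorm (B *ᵥ y i))) := by ring
      _ ≤ p i * (sqNorm (B.updateRow j r *ᵥ y i) / sqNorm (B *ᵥ y i) - 1) :=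
          mul_le_mul_of_nonneg_left h3 (hp i)
      _ = _ := by rw [h4]; field_simp; ring
  unfold potential
  linarith

lemma frameOp_diag_re_le {m n : ℕ} {p : Fin n → ℝ} (hp : ∀ i, 0 ≤ p i)
    {w : Fin n → Fin m → ℂ} (hw : ∀ i, w i ≠ 0) (a : Fin m) :
    (frameOp p w a a).re ≤ ∑ i, p i := by
  rw [frameOp_diag, Complex.ofReal_re]
  refine Finset.sum_le_sum fun i _ => ?_
  rw [div_mul_eq_mul_div, div_le_iff₀ (sqNorm_pos (hw i))]
  exact mul_le_mul_of_nonneg_left (normSq_le_sqNorm _ _) (hp i)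

/-- At an almost minimizer of the potential, the off-diagonal entries of the frame operator
are small. -/
lemma normSq_frameOp_le_of_almost_min {m n : ℕ} {p : Fin n → ℝ} (hp : ∀ i, 0 ≤ p i)
    (q : Fin m → ℝ) {y : Fin n → Fin m → ℂ} (hy : ∀ i, y i ≠ 0)
    {B : Matrix (Fin m) (Fin m) ℂ} (hB : LowerInv B) {δ : ℝ}
    (hmin : ∀ B', LowerInv B' → potential p q y B - δ ≤ potential p q y B')
    {k j : Fin m} (hkj : k < j) :
    Complex.normSq (frameOp p (fun i => B *ᵥ y i) k j) ≤ δ * (∑ i, p i + 1) := by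
  set w : Fin n → Fin m → ℂ := fun i => B *ᵥ y i with hw
  set N := frameOp p w k j with hN
  have hw0 : ∀ i, w i ≠ 0 := fun i => mulVec_ne_zero_of_isUnit_det hB.isUnit_det (hy i)
  have hP : 0 ≤ ∑ i, p i := Finset.sum_nonneg fun i _ => hp i
  set P := ∑ i, p i with hPdef
  set s : ℝ := 1 / (P + 1) with hs
  have hs0 : 0 < s := by positivity
  have hsP : s * (P + 1) = 1 := by rw [hs]; field_simp
  set z : ℂ := -(s : ℂ) * star N with hz
  have hB' : LowerInv (B.updateRow j (B j + z • B k)) := by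
    constructor
    · intro a b hab
      rcases eq_or_ne a j with rfl | ha
      · simp [hB.1 _ _ hab, hB.1 _ _ (hkj.trans hab)]
      · simp [ha, hB.1 _ _ hab]
    · intro a
      rcases eq_or_ne a j with rfl | ha
      · simp [hB.1 _ _ hkj, hB.2]
      · simp [ha, hB.2]
  have h1 := potential_updateRow_le hp q hy hB j _ hB'
  have h2 := hmin _ hB'
  have h3 : (B j + z • B k) j = B j j := by simp [hB.1 _ _ hkj]
  rw [h3, sub_self, mul_zero, sub_zero] at h1
  have h4 : ∑ i, p i / sqNorm (B *ᵥ y i) *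
      (Complex.normSq ((B j + z • B k) ⬝ᵥ y i) - Complex.normSq ((B *ᵥ y i) j)) =
      2 * (z * N).re + Complex.normSq z * (frameOp p w k k).re := by
    rw [frameOp_diag, Complex.ofReal_re, hN, frameOp_apply, Finset.mul_sum, Complex.re_sum,
      Finset.mul_sum, Finset.mul_sum, ← Finset.sum_add_distrib]
    refine Finset.sum_congr rfl fun i _ => ?_
    have : (B j + z • B k) ⬝ᵥ y i = w i j + z * w i k := by
      simp [hw, Matrix.mulVec, add_dotProduct, smul_dotProduct]
    rw [this, Complex.normSq_add, Complex.normSq_mul]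
    have h5 : (w i j * (starRingEnd ℂ) (z * w i k)).re = (z * (w i k * star (w i j))).re := by
      rw [← Complex.conj_re]
      congr 1
      simp
      ring
    have h6 : z * (((p i / sqNorm (w i) : ℝ) : ℂ) * (w i k * star (w i j))) =
      ((p i / sqNorm (w i) : ℝ) : ℂ) * (z * (w i k * star (w i j))) := by ring
    rw [h5, h6, Complex.re_ofReal_mul]
    simp only [hw]
    ring
  have h7 : (z * N).re = - s * Complex.normSq N := by
    have : z * N = ((-s * Complex.normSq N : ℝ) : ℂ) := by
      rw [hz, mul_assoc, Complex.star_def, mul_comm _ N, Complex.mul_conj]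
      push_cast; ring
    rw [this, Complex.ofReal_re]
  have h8 : Complex.normSq z = s ^ 2 * Complex.normSq N := by
    rw [hz, Complex.normSq_mul, Complex.star_def, Complex.normSq_conj, Complex.normSq_neg,
      Complex.normSq_ofReal]
    ring
  have h9 := frameOp_diag_re_le hp hw0 k
  have h10 := Complex.normSq_nonneg N
  rw [h4, h7, h8] at h1
  have h11 : s ^ 2 * Complex.normSq N * (frameOp p w k k).re ≤ s ^ 2 * Complex.normSq N * P :=
    mul_le_mul_of_nonneg_left h9 (by positivity)
  have h12 : s ^ 2 * Complex.normSq N * P = s * Complex.normSq N - s ^ 2 * Complex.normSq N := by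
    linear_combination (s * Complex.normSq N) * hsP
  have h13 : s * Complex.normSq N ≤ δ := by nlinarith [sq_nonneg s]
  calc Complex.normSq N = (s * Complex.normSq N) * (P + 1) := by
        linear_combination (-Complex.normSq N) * hsP
    _ ≤ δ * (P + 1) := mul_le_mul_of_nonneg_right h13 (by positivity)

/-- At an almost minimizer of the potential, the diagonal entries of the frame operator are
close to the prescribed ones. -/
lemma abs_frameOp_diag_sub_le_of_almost_min {m n : ℕ} {p : Fin n → ℝ} (hp : ∀ i, 0 ≤ p i)
    {q : Fin m → ℝ} (hq : ∀ j, 0 ≤ q j) {y : Fin n → Fin m → ℂ} (hy : ∀ i, y i ≠ 0)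
    {B : Matrix (Fin m) (Fin m) ℂ} (hB : LowerInv B) {δ s : ℝ} (hs0 : 0 < s) (hs : s ≤ 1 / 2)
    (hmin : ∀ B', LowerInv B' → potential p q y B - δ ≤ potential p q y B') (j : Fin m) :
    |(frameOp p (fun i => B *ᵥ y i) j j).re - q j| ≤ δ / s + 2 * q j * s := by
  set N := (frameOp p (fun i => B *ᵥ y i) j j).re with hN
  have key : ∀ x : ℝ, |x| = s → -δ ≤ x * (N - q j) + 2 * q j * s ^ 2 := by
    intro x hx
    have hx1 : 1 / 2 ≤ 1 + x := by
      have := neg_abs_le x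
      linarith
    have hx0 : 0 < 1 + x := by linarith
    set c : ℂ := ((Real.sqrt (1 + x) : ℝ) : ℂ) with hc
    have hcn : Complex.normSq c = 1 + x := by
      rw [hc, Complex.normSq_ofReal, Real.mul_self_sqrt hx0.le]
    have hc0 : c ≠ 0 := by
      rw [← Complex.normSq_pos, hcn]; exact hx0
    have hB' : LowerInv (B.updateRow j (c • B j)) := by
      constructor
      · intro a b hab
        rcases eq_or_ne a j with rfl | ha
        · simp [hB.1 _ _ hab]
        · simp [ha, hB.1 _ _ hab]
      · intro a
        rcases eq_or_ne a j with rfl | ha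
        · simp [hc0, hB.2]
        · simp [ha, hB.2]
    have h1 := potential_updateRow_le hp q hy hB j _ hB'
    have h2 := hmin _ hB'
    have h3 : Real.log (Complex.normSq ((c • B j) j)) - Real.log (Complex.normSq (B j j)) =
        Real.log (1 + x) := by
      rw [Pi.smul_apply, smul_eq_mul, Complex.normSq_mul, hcn,
        Real.log_mul hx0.ne' (Complex.normSq_pos.mpr (hB.2 j)).ne']
      ring
    have h4 : ∑ i, p i / sqNorm (B *ᵥ y i) *
        (Complex.normSq ((c • B j) ⬝ᵥ y i) - Complex.normSq ((B *ᵥ y i) j)) = x * N := by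
      rw [hN, frameOp_diag, Complex.ofReal_re, Finset.mul_sum]
      refine Finset.sum_congr rfl fun i _ => ?_
      have : (c • B j) ⬝ᵥ y i = c * (B *ᵥ y i) j := by
        simp [Matrix.mulVec, smul_dotProduct]
      rw [this, Complex.normSq_mul, hcn]
      ring
    rw [h3, h4] at h1
    have h5 : x - 2 * s ^ 2 ≤ Real.log (1 + x) := by
      have h6 := Real.one_sub_inv_le_log_of_pos hx0
      have h7 : x - 2 * s ^ 2 ≤ 1 - (1 + x)⁻¹ := by
        have h8 : 1 - (1 + x)⁻¹ = x - x ^ 2 * (1 + x)⁻¹ := by field_simp; ring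
        have h9 : (1 + x)⁻¹ ≤ 2 := by
          rw [inv_le_comm₀ hx0 two_pos]; linarith
        have h10 : x ^ 2 = s ^ 2 := by rw [← hx, sq_abs]
        rw [h8, h10]
        nlinarith [sq_nonneg s]
      linarith
    have h6 := mul_le_mul_of_nonneg_left h5 (hq j)
    linarith
  have h1 := key s (abs_of_pos hs0)
  have h2 := key (-s) (by rw [abs_neg, abs_of_pos hs0])
  have h3 : δ / s + 2 * q j * s = (δ + 2 * q j * s ^ 2) / s := by field_simp
  rw [h3, le_div_iff₀ hs0, ← abs_of_pos hs0, ← abs_mul, abs_of_pos hs0, abs_le]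
  constructor <;> linarith

/-- If the potential is bounded below, then the frame operator can be brought arbitrarily close
to `diag q` by invertible lower triangular matrices. -/
lemma exists_frameOp_near_diagonal {m n : ℕ} {p : Fin n → ℝ} (hp : ∀ i, 0 ≤ p i)
    {q : Fin m → ℝ} (hq : ∀ j, 0 ≤ q j) {y : Fin n → Fin m → ℂ} (hy : ∀ i, y i ≠ 0)
    {C : ℝ} (hC : ∀ B, LowerInv B → C ≤ potential p q y B) {η : ℝ} (hη : 0 < η) :
    ∃ B, LowerInv B ∧ ∀ a b,
      ‖(frameOp p (fun i => B *ᵥ y i) - diagonal fun j => (q j : ℂ)) a b‖ ≤ η := by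
  have hP : 0 ≤ ∑ i, p i := Finset.sum_nonneg fun i _ => hp i
  have hQ : 0 ≤ ∑ j, q j := Finset.sum_nonneg fun i _ => hq i
  set s : ℝ := min (1 / 2) (η / (4 * (∑ j, q j + 1))) with hs
  have hs0 : 0 < s := by positivity
  have hs1 : s ≤ 1 / 2 := min_le_left _ _
  have hsq : ∀ j, 2 * q j * s ≤ η / 2 := by
    intro j
    have h1 : s ≤ η / (4 * (∑ j, q j + 1)) := min_le_right _ _
    rw [le_div_iff₀ (by positivity)] at h1
    have h2 : q j ≤ ∑ j, q j := Finset.single_le_sum (fun j _ => hq j) (Finset.mem_univ j)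
    nlinarith
  set δ : ℝ := min (s * η / 2) (η ^ 2 / (∑ i, p i + 1)) with hδ
  have hδ0 : 0 < δ := by positivity
  have hone : LowerInv (1 : Matrix (Fin m) (Fin m) ℂ) :=
    ⟨fun i j h => by simp [h.ne], fun i => by simp⟩
  have hbdd : BddBelow (potential p q y '' {B | LowerInv B}) :=
    ⟨C, by rintro _ ⟨B, hB, rfl⟩; exact hC B hB⟩
  obtain ⟨_, ⟨B, hB, rfl⟩, hlt⟩ := exists_lt_of_csInf_lt
    (Set.Nonempty.image (potential p q y) ⟨_, hone⟩)
    (lt_add_of_pos_right (sInf (potential p q y '' {B | LowerInv B})) hδ0)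
  have hmin : ∀ B', LowerInv B' → potential p q y B - δ ≤ potential p q y B' := by
    intro B' hB'
    have := csInf_le hbdd ⟨B', hB', rfl⟩
    linarith
  have hoff : ∀ a b : Fin m, a < b → ‖frameOp p (fun i => B *ᵥ y i) a b‖ ≤ η := by
    intro a b hab
    have h1 := normSq_frameOp_le_of_almost_min hp q hy hB hmin hab
    have h2 : δ * (∑ i, p i + 1) ≤ η ^ 2 := by
      have : δ ≤ η ^ 2 / (∑ i, p i + 1) := min_le_right _ _
      rwa [le_div_iff₀ (by positivity)] at this
    rw [Complex.normSq_eq_norm_sq] at h1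
    exact le_of_sq_le_sq (h1.trans h2) hη.le
  refine ⟨B, hB, fun a b => ?_⟩
  rcases lt_trichotomy a b with h | rfl | h
  · simpa [h.ne] using hoff a b h
  · have h1 := abs_frameOp_diag_sub_le_of_almost_min hp hq hy hB hs0 hs1 hmin a
    have h2 : δ / s ≤ η / 2 := by
      rw [div_le_iff₀ hs0]
      have : δ ≤ s * η / 2 := min_le_left _ _
      linarith
    have h3 := hsq a
    rw [Matrix.sub_apply, diagonal_apply_eq, frameOp_diag, ← Complex.ofReal_sub,
      Complex.norm_real, Real.norm_eq_abs]
    rw [frameOp_diag, Complex.ofReal_re] at h1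
    linarith
  · rw [Matrix.sub_apply, diagonal_apply_ne _ h.ne', sub_zero, frameOp_apply_swap, norm_star]
    exact hoff b a h

/-- The leading principal minor of size `k`. -/
def leadingMinor {m : ℕ} {R : Type*} [CommRing R] (A : Matrix (Fin m) (Fin m) R) (k : ℕ)
    (hk : k ≤ m) : R :=
  (A.submatrix (Fin.castLE hk) (Fin.castLE hk)).det

lemma map_leadingMinor {m : ℕ} {R S : Type*} [CommRing R] [CommRing S] (f : R →+* S)
    (A : Matrix (Fin m) (Fin m) R) (k : ℕ) (hk : k ≤ m) :
    f (leadingMinor A k hk) = leadingMinor (A.map f) k hk := by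
  unfold leadingMinor
  rw [RingHom.map_det]
  rfl

lemma leadingMinor_one {m : ℕ} {R : Type*} [CommRing R] (k : ℕ) (hk : k ≤ m) :
    leadingMinor (1 : Matrix (Fin m) (Fin m) R) k hk = 1 := by
  unfold leadingMinor
  rw [Matrix.submatrix_one _ (Fin.castLE_injective hk), det_one]

lemma leadingMinor_self {m : ℕ} {R : Type*} [CommRing R] (A : Matrix (Fin m) (Fin m) R) :
    leadingMinor A m le_rfl = A.det := rfl

/-- For finitely many invertible matrices `V`, a generic `g` makes all leading principal minors
of every `g * V` nonzero. -/
lemma exists_leadingMinor_mul_ne_zero {m : ℕ} (s : Finset (Matrix (Fin m) (Fin m) ℂ))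
    (hs : ∀ V ∈ s, IsUnit V.det) :
    ∃ g : Matrix (Fin m) (Fin m) ℂ, ∀ V ∈ s, ∀ k (hk : k ≤ m), leadingMinor (g * V) k hk ≠ 0 := by
  classical
  set P : Matrix (Fin m) (Fin m) ℂ → Fin (m + 1) → MvPolynomial (Fin m × Fin m) ℂ := fun V k =>
    leadingMinor (mvPolynomialX (Fin m) (Fin m) ℂ * V.map MvPolynomial.C) k (Nat.le_of_lt_succ k.2)
    with hP
  have heval : ∀ V k (g : Matrix (Fin m) (Fin m) ℂ),
      MvPolynomial.eval (fun ij => g ij.1 ij.2) (P V k) =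
        leadingMinor (g * V) k (Nat.le_of_lt_succ k.2) := by
    intro V k g
    rw [hP, map_leadingMinor, Matrix.map_mul]
    congr 2
    · ext i j; simp
    · ext i j; simp
  have hne : ∏ V ∈ s, ∏ k, P V k ≠ 0 := by
    refine Finset.prod_ne_zero_iff.mpr fun V hV => Finset.prod_ne_zero_iff.mpr fun k _ h0 => ?_
    have h1 := heval V k V⁻¹
    rw [h0, map_zero, Matrix.nonsing_inv_mul _ (hs V hV), leadingMinor_one] at h1
    exact zero_ne_one h1
  obtain ⟨x, hx⟩ : ∃ x, MvPolynomial.eval x (∏ V ∈ s, ∏ k, P V k) ≠ 0 := by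
    by_contra! h
    exact hne (MvPolynomial.funext fun x => by rw [h x, map_zero])
  refine ⟨Matrix.of fun i j => x (i, j), fun V hV k hk => ?_⟩
  simp only [map_prod] at hx
  have h1 := Finset.prod_ne_zero_iff.mp (Finset.prod_ne_zero_iff.mp hx V hV)
    ⟨k, Nat.lt_succ_of_le hk⟩ (Finset.mem_univ _)
  rwa [← heval V ⟨k, Nat.lt_succ_of_le hk⟩]

lemma leadingMinor_mul_of_lower {m : ℕ} {B : Matrix (Fin m) (Fin m) ℂ} (hB : LowerInv B)
    (A : Matrix (Fin m) (Fin m) ℂ) (k : ℕ) (hk : k ≤ m) :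
    leadingMinor (B * A) k hk =
      (∏ b : Fin k, B (Fin.castLE hk b) (Fin.castLE hk b)) * leadingMinor A k hk := by
  have h1 : (B * A).submatrix (Fin.castLE hk) (Fin.castLE hk) =
      B.submatrix (Fin.castLE hk) (Fin.castLE hk) *
        A.submatrix (Fin.castLE hk) (Fin.castLE hk) := by
    ext a b
    simp only [submatrix_apply, mul_apply]
    rw [← Finset.sum_subset (Finset.subset_univ (Finset.univ.map (Fin.castLEEmb hk))),
      Finset.sum_map]
    · rfl
    · intro l _ hl
      rw [hB.1, zero_mul]
      by_contra h
      refine hl (Finset.mem_map.mpr ⟨⟨l, ?_⟩, Finset.mem_univ _, by ext; simp⟩)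
      exact lt_of_le_of_lt (not_lt.mp h) a.2
  have h2 : LowerInv (B.submatrix (Fin.castLE hk) (Fin.castLE hk)) :=
    ⟨fun i j hij => hB.1 _ _ hij, fun i => hB.2 _⟩
  unfold leadingMinor
  rw [h1, det_mul, h2.det_eq]
  rfl

lemma norm_det_le_prod {k : ℕ} (M : Matrix (Fin k) (Fin k) ℂ) (c : Fin k → ℝ)
    (hc : ∀ a b, ‖M a b‖ ≤ c b) : ‖M.det‖ ≤ k.factorial * ∏ b, c b := by
  rw [det_apply]
  refine (norm_sum_le _ _).trans ?_
  have : ∀ σ ∈ (Finset.univ : Finset (Equiv.Perm (Fin k))),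
      ‖Equiv.Perm.sign σ • ∏ i, M (σ i) i‖ ≤ ∏ b, c b := by
    intro σ _
    have h1 : ‖Equiv.Perm.sign σ • ∏ i, M (σ i) i‖ = ∏ i, ‖M (σ i) i‖ := by
      rcases Int.units_eq_one_or (Equiv.Perm.sign σ) with h | h <;> simp [h]
    rw [h1]
    exact Finset.prod_le_prod (fun _ _ => norm_nonneg _) fun i _ => hc _ _
  refine (Finset.sum_le_card_nsmul _ _ _ this).trans (le_of_eq ?_)
  rw [Finset.card_univ, Fintype.card_perm, Fintype.card_fin, nsmul_eq_mul]

/-- Summation by parts: if all partial sums of `x` are at least `-C`, then a sum with antitone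
nonnegative weights bounded by `R` is at least `-(R * C)`. -/
lemma neg_mul_le_sum_antitone_mul {m : ℕ} {q : Fin m → ℝ} (hqa : Antitone q) (hq : ∀ i, 0 ≤ q i)
    {R : ℝ} (hR : ∀ i, q i ≤ R) (hR0 : 0 ≤ R) (x : Fin m → ℝ) {C : ℝ}
    (h : ∀ k (hk : k ≤ m), -C ≤ ∑ b : Fin k, x (Fin.castLE hk b)) :
    -(R * C) ≤ ∑ i, q i * x i := by
  have hC : 0 ≤ C := by simpa using h 0 (Nat.zero_le m)
  have key : ∀ k (hk : k ≤ m) (t : ℝ), 0 ≤ t → t ≤ R → (∀ b : Fin k, t ≤ q (Fin.castLE hk b)) →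
      t * (∑ b : Fin k, x (Fin.castLE hk b) + C) - R * C ≤
        ∑ b : Fin k, q (Fin.castLE hk b) * x (Fin.castLE hk b) := by
    intro k
    induction k with
    | zero =>
      intro hk t _ htR _
      simp [mul_le_mul_of_nonneg_right htR hC]
    | succ k ih =>
      intro hk t ht htR htq
      have h1 := ih (Nat.le_of_succ_le hk) (q (Fin.castLE hk (Fin.last k))) (hq _) (hR _)
        fun b => hqa (by
          rw [Fin.le_def]
          simp)
      have h2 := h (k + 1) hk
      have h3 := htq (Fin.last k)
      rw [Fin.sum_univ_castSucc] at h2 ⊢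
      rw [Fin.sum_univ_castSucc]
      simp only [Fin.castLE_castSucc] at h2 ⊢
      nlinarith [mul_le_mul_of_nonneg_right h3 (neg_le_iff_add_nonneg.mp h2)]
  simpa using key m le_rfl 0 le_rfl hR0 fun b => hq _

lemma exists_le_sum_log_sqNorm {m : ℕ} {q : Fin m → ℝ} (hqa : Antitone q) (hq : ∀ i, 0 ≤ q i)
    (A : Matrix (Fin m) (Fin m) ℂ) (hA : ∀ k (hk : k ≤ m), leadingMinor A k hk ≠ 0) :
    ∃ C, ∀ B, LowerInv B → C ≤ ∑ k, q k *
      (Real.log (sqNorm (B *ᵥ A.col k)) - Real.log (Complex.normSq (B k k))) := by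
  have hR0 : 0 ≤ ∑ i, q i := Finset.sum_nonneg fun i _ => hq i
  have hR : ∀ i, q i ≤ ∑ i, q i := fun i =>
    Finset.single_le_sum (fun j _ => hq j) (Finset.mem_univ i)
  set D : Fin (m + 1) → ℝ := fun k =>
    2 * Real.log (k : ℕ).factorial -
      Real.log (Complex.normSq (leadingMinor A k (Nat.le_of_lt_succ k.2))) with hD
  refine ⟨-((∑ i, q i) * ∑ k, |D k|), fun B hB =>
    neg_mul_le_sum_antitone_mul hqa hq hR hR0 _ fun k hk => ?_⟩
  have hcol : ∀ b, A.col b ≠ 0 := by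
    intro b hb
    refine hA m le_rfl ?_
    rw [leadingMinor_self]
    exact det_eq_zero_of_column_eq_zero b fun i => congrFun hb i
  have hpos : ∀ b, 0 < sqNorm (B *ᵥ A.col b) := fun b =>
    sqNorm_pos (mulVec_ne_zero_of_isUnit_det hB.isUnit_det (hcol b))
  have h1 : ‖leadingMinor (B * A) k hk‖ ≤
      k.factorial * ∏ b : Fin k, Real.sqrt (sqNorm (B *ᵥ A.col (Fin.castLE hk b))) := by
    refine norm_det_le_prod _ _ fun a b => Real.le_sqrt_of_sq_le ?_
    rw [← Complex.normSq_eq_norm_sq]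
    exact normSq_le_sqNorm (B *ᵥ A.col (Fin.castLE hk b)) (Fin.castLE hk a)
  rw [leadingMinor_mul_of_lower hB, norm_mul, norm_prod] at h1
  have hBn : ∀ b : Fin k, ‖B (Fin.castLE hk b) (Fin.castLE hk b)‖ ≠ 0 := fun b =>
    norm_ne_zero_iff.mpr (hB.2 _)
  have hAn : ‖leadingMinor A k hk‖ ≠ 0 := norm_ne_zero_iff.mpr (hA k hk)
  have hsn : ∀ b : Fin k, Real.sqrt (sqNorm (B *ᵥ A.col (Fin.castLE hk b))) ≠ 0 := fun b =>
    (Real.sqrt_pos.mpr (hpos _)).ne'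
  have h2 := Real.log_le_log (mul_pos (Finset.prod_pos fun b _ => norm_pos_iff.mpr (hB.2 _))
    (norm_pos_iff.mpr (hA k hk))) h1
  rw [Real.log_mul (Finset.prod_ne_zero_iff.mpr fun b _ => hBn b) hAn,
    Real.log_mul (by positivity) (Finset.prod_ne_zero_iff.mpr fun b _ => hsn b),
    Real.log_prod fun b _ => hBn b, Real.log_prod fun b _ => hsn b] at h2
  have h3 : D ⟨k, Nat.lt_succ_of_le hk⟩ ≤ ∑ k, |D k| :=
    (le_abs_self _).trans
      (Finset.single_le_sum (f := fun k => |D k|) (fun _ _ => abs_nonneg _) (Finset.mem_univ _))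
  have h6 : D ⟨k, Nat.lt_succ_of_le hk⟩ =
      2 * Real.log k.factorial - 2 * Real.log ‖leadingMinor A k hk‖ := by
    simp [hD, Complex.normSq_eq_norm_sq, Real.log_pow]
  rw [Finset.sum_sub_distrib]
  have h4 : ∑ b : Fin k, Real.log (sqNorm (B *ᵥ A.col (Fin.castLE hk b))) =
      2 * ∑ b : Fin k, Real.log (Real.sqrt (sqNorm (B *ᵥ A.col (Fin.castLE hk b)))) := by
    rw [Finset.mul_sum]
    refine Finset.sum_congr rfl fun b _ => ?_
    rw [Real.log_sqrt (hpos _).le]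
    ring
  have h5 : ∑ b : Fin k, Real.log (Complex.normSq (B (Fin.castLE hk b) (Fin.castLE hk b))) =
      2 * ∑ b : Fin k, Real.log ‖B (Fin.castLE hk b) (Fin.castLE hk b)‖ := by
    rw [Finset.mul_sum]
    refine Finset.sum_congr rfl fun b _ => ?_
    rw [Complex.normSq_eq_norm_sq, Real.log_pow]
    norm_num
  rw [h4, h5]
  linarith

lemma sum_extend_mul {m n : ℕ} {S : Finset (Fin n)} (σ : {i // i ∈ S} ≃ Fin m) (q : Fin m → ℝ)
    (f : Fin n → ℝ) :
    ∑ i, (if h : i ∈ S then q (σ ⟨i, h⟩) else 0) * f i = ∑ k, q k * f (σ.symm k) := by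
  rw [← σ.sum_comp, ← Finset.sum_subset (Finset.subset_univ S) fun i _ hi => by simp [hi],
    ← Finset.sum_coe_sort S]
  simp

lemma isUnit_det_of_span_eq_top {m n : ℕ} (u : Fin n → Fin m → ℂ) {S : Finset (Fin n)}
    (hS : Submodule.span ℂ (u '' (S : Set (Fin n))) = ⊤) (σ : {i // i ∈ S} ≃ Fin m) :
    IsUnit (Matrix.of fun a k => u (σ.symm k) a).det := by
  rw [← Matrix.isUnit_iff_isUnit_det, ← Matrix.linearIndependent_cols_iff_isUnit]
  refine linearIndependent_of_top_le_span_of_card_eq_finrank ?_ (by simp)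
  rw [← hS]
  refine Submodule.span_mono ?_
  rintro _ ⟨i, hi, rfl⟩
  exact ⟨σ ⟨i, hi⟩, by ext; simp [Matrix.col]⟩

/-- The vectors placing the entries of `q` on a basis among the `u i`. -/
def basisVertices {m n : ℕ} (u : Fin n → Fin m → ℂ) (q : Fin m → ℝ) : Set (Fin n → ℝ) :=
  { v : Fin n → ℝ | ∃ S : Finset (Fin n), S.card = m ∧
    Submodule.span ℂ (u '' (S : Set (Fin n))) = ⊤ ∧
    ∃ σ : {i // i ∈ S} ≃ Fin m, v = fun i => if h : i ∈ S then q (σ ⟨i, h⟩) else 0 }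

/-- For a suitable change of basis `g`, the potential is bounded below for all weights in the
convex hull of the basis vertices. -/
lemma exists_potential_bddBelow {m n : ℕ} (u : Fin n → Fin m → ℂ) {q : Fin m → ℝ}
    (hqa : Antitone q) (hq : ∀ i, 0 ≤ q i) :
    ∃ g : Matrix (Fin m) (Fin m) ℂ, IsUnit g.det ∧ ∀ p ∈ convexHull ℝ (basisVertices u q),
      ∃ C, ∀ B, LowerInv B → C ≤ potential p q (fun i => g *ᵥ u i) B := by
  classical
  obtain ⟨g, hg⟩ := exists_leadingMinor_mul_ne_zero
    (insert 1 ((Finset.univ.image fun e : Fin m → Fin n =>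
      (Matrix.of fun a k => u (e k) a : Matrix (Fin m) (Fin m) ℂ)).filter fun V => IsUnit V.det))
    (by
      intro V hV
      rcases Finset.mem_insert.mp hV with rfl | hV
      · simp
      · exact (Finset.mem_filter.mp hV).2)
  refine ⟨g, ?_, fun p hp => ?_⟩
  · have := hg 1 (Finset.mem_insert_self _ _) m le_rfl
    rwa [mul_one, leadingMinor_self, ← isUnit_iff_ne_zero] at this
  · refine convexHull_min (s := basisVertices u q)
      (t := {p | ∃ C, ∀ B, LowerInv B → C ≤ potential p q (fun i => g *ᵥ u i) B}) ?_ ?_ hp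
    · rintro v ⟨S, -, hS, σ, rfl⟩
      have hunit := isUnit_det_of_span_eq_top u hS σ
      obtain ⟨C, hC⟩ := exists_le_sum_log_sqNorm hqa hq
        (g * Matrix.of fun a k => u (σ.symm k) a)
        (hg _ (Finset.mem_insert_of_mem (Finset.mem_filter.mpr
          ⟨Finset.mem_image_of_mem _ (Finset.mem_univ fun k => (σ.symm k : Fin n)), hunit⟩)))
      refine ⟨C, fun B hB => (hC B hB).trans_eq ?_⟩
      unfold potential
      rw [sum_extend_mul σ q fun i => Real.log (sqNorm (B *ᵥ g *ᵥ u i)),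
        ← Finset.sum_sub_distrib]
      refine Finset.sum_congr rfl fun k _ => ?_
      have : (g * Matrix.of fun a k => u (σ.symm k) a).col k = g *ᵥ u (σ.symm k) := by
        ext a
        simp [Matrix.col, Matrix.mul_apply, Matrix.mulVec, dotProduct]
      rw [this, mul_sub]
    · rintro p₁ ⟨C₁, h₁⟩ p₂ ⟨C₂, h₂⟩ a b ha hb hab
      refine ⟨a * C₁ + b * C₂, fun B hB => ?_⟩
      have h3 : potential (a • p₁ + b • p₂) q (fun i => g *ᵥ u i) B =
          a * potential p₁ q (fun i => g *ᵥ u i) B + b * potential p₂ q (fun i => g *ᵥ u i) B := by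
        unfold potential
        have h4 : ∑ i, (a • p₁ + b • p₂) i * Real.log (sqNorm (B *ᵥ g *ᵥ u i)) =
            a * ∑ i, p₁ i * Real.log (sqNorm (B *ᵥ g *ᵥ u i)) +
              b * ∑ i, p₂ i * Real.log (sqNorm (B *ᵥ g *ᵥ u i)) := by
          rw [Finset.mul_sum, Finset.mul_sum, ← Finset.sum_add_distrib]
          refine Finset.sum_congr rfl fun i _ => ?_
          simp only [Pi.add_apply, Pi.smul_apply, smul_eq_mul]
          ring
        rw [h4]
        linear_combination (∑ j, q j * Real.log (Complex.normSq (B j j))) * hab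
      rw [h3]
      exact add_le_add (mul_le_mul_of_nonneg_left (h₁ B hB) ha)
        (mul_le_mul_of_nonneg_left (h₂ B hB) hb)

lemma frob_eq_sqrt_sum {m : ℕ} (M : Matrix (Fin m) (Fin m) ℂ) :
    frob M = Real.sqrt (∑ a, ∑ b, ‖M a b‖ ^ 2) := by
  unfold frob
  congr 1
  simp only [Matrix.trace, Matrix.diag, Matrix.mul_apply, conjTranspose_apply, Complex.re_sum]
  refine Finset.sum_congr rfl fun a _ => Finset.sum_congr rfl fun b _ => ?_
  rw [Complex.star_def, Complex.mul_conj, Complex.ofReal_re, Complex.normSq_eq_norm_sq]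

lemma frob_le_of_norm_le {m : ℕ} {M : Matrix (Fin m) (Fin m) ℂ} {η : ℝ} (hη : 0 ≤ η)
    (h : ∀ a b, ‖M a b‖ ≤ η) : frob M ≤ m * η := by
  rw [frob_eq_sqrt_sum]
  refine Real.sqrt_le_iff.mpr ⟨by positivity, ?_⟩
  calc ∑ a, ∑ b, ‖M a b‖ ^ 2 ≤ ∑ _a : Fin m, ∑ _b : Fin m, η ^ 2 := by gcongr; exact h _ _
    _ = (m * η) ^ 2 := by simp; ring

lemma frob_conj_unitary {m : ℕ} {U : Matrix (Fin m) (Fin m) ℂ}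
    (hU : U ∈ Matrix.unitaryGroup (Fin m) ℂ) (M : Matrix (Fin m) (Fin m) ℂ) :
    frob (U * M * Uᴴ) = frob M := by
  have h1 : Uᴴ * U = 1 := Matrix.mem_unitaryGroup_iff'.mp hU
  have h2 : U * M * Uᴴ * (U * M * Uᴴ)ᴴ = U * (M * Mᴴ * Uᴴ) := by
    rw [conjTranspose_mul, conjTranspose_mul, conjTranspose_conjTranspose]
    calc U * M * Uᴴ * (U * (Mᴴ * Uᴴ)) = U * M * (Uᴴ * U) * (Mᴴ * Uᴴ) := by noncomm_ring
      _ = _ := by rw [h1]; noncomm_ring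
  unfold frob
  rw [h2, Matrix.trace_mul_comm, mul_assoc, h1, mul_one]

lemma sqNorm_eq_dotProduct {m : ℕ} (x : Fin m → ℂ) : ((sqNorm x : ℝ) : ℂ) = star x ⬝ᵥ x := by
  simp [sqNorm, dotProduct, Complex.normSq_eq_conj_mul_self]

lemma sqNorm_unitary_mulVec {m : ℕ} {U : Matrix (Fin m) (Fin m) ℂ}
    (hU : U ∈ Matrix.unitaryGroup (Fin m) ℂ) (x : Fin m → ℂ) : sqNorm (U *ᵥ x) = sqNorm x := by
  have h1 : Uᴴ * U = 1 := Matrix.mem_unitaryGroup_iff'.mp hU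
  apply Complex.ofReal_injective
  rw [sqNorm_eq_dotProduct, sqNorm_eq_dotProduct, star_mulVec, ← dotProduct_mulVec,
    mulVec_mulVec, h1, one_mulVec]

lemma frameOp_unitary_mulVec {m n : ℕ} {U : Matrix (Fin m) (Fin m) ℂ}
    (hU : U ∈ Matrix.unitaryGroup (Fin m) ℂ) (p : Fin n → ℝ) (w : Fin n → Fin m → ℂ) :
    frameOp p (fun i => U *ᵥ w i) = U * frameOp p w * Uᴴ := by
  unfold frameOp
  rw [Finset.mul_sum, Finset.sum_mul]
  refine Finset.sum_congr rfl fun i _ => ?_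
  rw [sqNorm_unitary_mulVec hU, star_mulVec, Matrix.mul_smul, Matrix.smul_mul,
    Matrix.mul_vecMulVec, Matrix.vecMulVec_mul]

lemma approxIso_of_mem_convexHull {m n : ℕ} {u : Fin n → Fin m → ℂ} (hu : ∀ i, u i ≠ 0)
    {p : Fin n → ℝ} (hp : ∀ i, 0 ≤ p i) {q : Fin m → ℝ} (hqa : Antitone q) (hq : ∀ i, 0 ≤ q i)
    {U : Matrix (Fin m) (Fin m) ℂ} (hU : U ∈ Matrix.unitaryGroup (Fin m) ℂ)
    (h : p ∈ convexHull ℝ (basisVertices u q)) :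
    approxIso u p (U * Matrix.diagonal (fun i => (q i : ℂ)) * Uᴴ) := by
  intro ε hε
  obtain ⟨g, hg, hgC⟩ := exists_potential_bddBelow u hqa hq
  obtain ⟨C, hC⟩ := hgC p h
  have hη : 0 < ε / (m + 1) := by positivity
  obtain ⟨B, hB, hBη⟩ := exists_frameOp_near_diagonal hp hq
    (fun i => mulVec_ne_zero_of_isUnit_det hg (hu i)) hC hη
  have hUdet : IsUnit U.det := by
    have h1 : Uᴴ * U = 1 := Matrix.mem_unitaryGroup_iff'.mp hU
    rw [← Matrix.isUnit_iff_isUnit_det]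
    exact IsUnit.of_mul_eq_one_right _ h1
  refine ⟨U * (B * g), ?_, ?_⟩
  · rw [det_mul, det_mul]
    exact hUdet.mul (hB.isUnit_det.mul hg)
  · change frob (frameOp p (fun i => (U * (B * g)) *ᵥ u i) - _) ≤ ε
    simp only [← mulVec_mulVec]
    rw [frameOp_unitary_mulVec hU p fun i => B *ᵥ g *ᵥ u i, ← Matrix.sub_mul, ← Matrix.mul_sub,
      frob_conj_unitary hU]
    refine (frob_le_of_norm_le hη.le hBη).trans ?_
    rw [mul_div_assoc', div_le_iff₀ (by positivity)]
    nlinarith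

lemma abs_re_quadForm_le {m : ℕ} (M : Matrix (Fin m) (Fin m) ℂ) (x : Fin m → ℂ) :
    |(star x ⬝ᵥ M *ᵥ x).re| ≤ frob M * sqNorm x := by
  have h1 : star x ⬝ᵥ M *ᵥ x = ∑ ab : Fin m × Fin m, M ab.1 ab.2 * (star (x ab.1) * x ab.2) := by
    simp only [dotProduct, mulVec, Fintype.sum_prod_type, Finset.mul_sum, Pi.star_apply]
    exact Finset.sum_congr rfl fun a _ => Finset.sum_congr rfl fun b _ => by ring
  have h2 : ∑ ab : Fin m × Fin m, ‖star (x ab.1) * x ab.2‖ ^ 2 = sqNorm x ^ 2 := by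
    simp only [norm_mul, norm_star, mul_pow, Fintype.sum_prod_type, sqNorm, sq (∑ a, _),
      Finset.sum_mul_sum, Complex.normSq_eq_norm_sq]
  have h3 : ‖star x ⬝ᵥ M *ᵥ x‖ ≤
      ∑ ab : Fin m × Fin m, ‖M ab.1 ab.2‖ * ‖star (x ab.1) * x ab.2‖ := by
    rw [h1]
    refine (norm_sum_le _ _).trans_eq ?_
    exact Finset.sum_congr rfl fun ab _ => norm_mul _ _
  refine (Complex.abs_re_le_norm _).trans (h3.trans ?_)
  refine (Real.sum_mul_le_sqrt_mul_sqrt _ _ _).trans_eq ?_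
  rw [h2, Real.sqrt_sq (sqNorm_nonneg x), frob_eq_sqrt_sum, Fintype.sum_prod_type]

lemma re_quadForm_frameOp {m n : ℕ} (p : Fin n → ℝ) (w : Fin n → Fin m → ℂ) (x : Fin m → ℂ) :
    (star x ⬝ᵥ frameOp p w *ᵥ x).re =
      ∑ i, p i / sqNorm (w i) * Complex.normSq (star x ⬝ᵥ w i) := by
  unfold frameOp
  rw [sum_mulVec, dotProduct_sum, Complex.re_sum]
  refine Finset.sum_congr rfl fun i _ => ?_
  have h1 : star (w i) ⬝ᵥ x = star (star x ⬝ᵥ w i) := by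
    rw [← star_dotProduct_star, star_star]
  rw [smul_mulVec, dotProduct_smul, vecMulVec_mulVec, h1, dotProduct_smul, smul_eq_mul,
    Complex.re_ofReal_mul]
  congr 1
  simp only [MulOpposite.smul_eq_mul_unop, MulOpposite.unop_op]
  rw [Complex.star_def, Complex.mul_conj, Complex.ofReal_re]

lemma re_quadForm_conj_diagonal {m : ℕ} (U : Matrix (Fin m) (Fin m) ℂ) (q : Fin m → ℝ)
    (x : Fin m → ℂ) :
    (star x ⬝ᵥ (U * diagonal (fun i => (q i : ℂ)) * Uᴴ) *ᵥ x).re =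
      ∑ l, q l * Complex.normSq ((Uᴴ *ᵥ x) l) := by
  have h1 : star x ᵥ* U = star (Uᴴ *ᵥ x) := by rw [star_mulVec, conjTranspose_conjTranspose]
  rw [← mulVec_mulVec, ← mulVec_mulVec, dotProduct_mulVec, h1, dotProduct, Complex.re_sum]
  refine Finset.sum_congr rfl fun l _ => ?_
  rw [mulVec_diagonal, Pi.star_apply, mul_left_comm, Complex.re_ofReal_mul, Complex.star_def,
    ← Complex.normSq_eq_conj_mul_self, Complex.ofReal_re]

lemma sum_mul_doublyStochastic_le {m : ℕ} {M : Matrix (Fin m) (Fin m) ℝ}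
    (hM : M ∈ doublyStochastic ℝ (Fin m)) (a q : Fin m → ℝ) {t : ℝ}
    (h : ∀ σ : Equiv.Perm (Fin m), ∑ k, a k * q (σ k) ≤ t) :
    ∑ k, a k * ∑ l, q l * M k l ≤ t := by
  rw [← SetLike.mem_coe, doublyStochastic_eq_convexHull_permMatrix] at hM
  refine convexHull_min (t := {M : Matrix (Fin m) (Fin m) ℝ | ∑ k, a k * ∑ l, q l * M k l ≤ t})
    ?_ ?_ hM
  · rintro _ ⟨σ, rfl⟩
    refine le_trans (le_of_eq ?_) (h σ)
    refine Finset.sum_congr rfl fun k _ => ?_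
    congr 1
    simp [Equiv.Perm.permMatrix, PEquiv.toMatrix_apply]
  · intro M₁ h₁ M₂ h₂ b c hb hc hbc
    have h3 : ∑ k, a k * ∑ l, q l * (b • M₁ + c • M₂) k l =
        b * ∑ k, a k * ∑ l, q l * M₁ k l + c * ∑ k, a k * ∑ l, q l * M₂ k l := by
      simp only [Finset.mul_sum, ← Finset.sum_add_distrib]
      refine Finset.sum_congr rfl fun k _ => Finset.sum_congr rfl fun l _ => ?_
      simp only [Matrix.add_apply, Matrix.smul_apply, smul_eq_mul]
      ring
    calc _ = _ := h3
      _ ≤ b * t + c * t :=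
        add_le_add (mul_le_mul_of_nonneg_left h₁ hb) (mul_le_mul_of_nonneg_left h₂ hc)
      _ = t := by rw [← add_mul, hbc, one_mul]

lemma sqNorm_eq_norm_sq {m : ℕ} (x : EuclideanSpace ℂ (Fin m)) : sqNorm x.ofLp = ‖x‖ ^ 2 := by
  rw [EuclideanSpace.norm_sq_eq]
  exact Finset.sum_congr rfl fun a _ => Complex.normSq_eq_norm_sq _

lemma normSq_star_dotProduct {m : ℕ} (x y : EuclideanSpace ℂ (Fin m)) :
    Complex.normSq (star x.ofLp ⬝ᵥ y.ofLp) = ‖inner ℂ x y‖ ^ 2 := by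
  rw [Complex.normSq_eq_norm_sq, EuclideanSpace.inner_eq_star_dotProduct, dotProduct_comm]

lemma normSq_unitary_orthonormalBasis_mem_doublyStochastic {m : ℕ} {U : Matrix (Fin m) (Fin m) ℂ}
    (hU : U ∈ Matrix.unitaryGroup (Fin m) ℂ)
    (o : OrthonormalBasis (Fin m) ℂ (EuclideanSpace ℂ (Fin m))) :
    (Matrix.of fun k l => Complex.normSq ((Uᴴ *ᵥ (o k).ofLp) l)) ∈ doublyStochastic ℝ (Fin m) := by
  refine mem_doublyStochastic_iff_sum.mpr ⟨fun k l => Complex.normSq_nonneg _, fun k => ?_,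
    fun l => ?_⟩
  · change sqNorm (Uᴴ *ᵥ (o k).ofLp) = 1
    have hU' : Uᴴ ∈ Matrix.unitaryGroup (Fin m) ℂ := Unitary.star_mem hU
    rw [sqNorm_unitary_mulVec hU', sqNorm_eq_norm_sq, o.orthonormal.1 k,
      one_pow]
  · have h1 : ∀ k, Complex.normSq ((Uᴴ *ᵥ (o k).ofLp) l) =
        ‖inner ℂ (WithLp.toLp 2 (U.col l)) (o k)‖ ^ 2 := fun k => by
      rw [← normSq_star_dotProduct]
      rfl
    have h2 : Uᴴ * U = 1 := Matrix.mem_unitaryGroup_iff'.mp hU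
    have h3 : sqNorm (U.col l) = 1 := by
      apply Complex.ofReal_injective
      have := congrFun (congrFun h2 l) l
      rw [one_apply_eq] at this
      rw [sqNorm_eq_dotProduct, Complex.ofReal_one, ← this]
      rfl
    simp only [Matrix.of_apply, h1]
    rw [o.sum_sq_norm_inner_left, ← sqNorm_eq_norm_sq]
    exact h3

open InnerProductSpace in
/-- Gram–Schmidt applied to vectors listed by decreasing cost `c` selects a basis of greatest
cost together with an adapted orthonormal basis. -/
lemma exists_greedy_basis_of_antitone {m n : ℕ} (w : Fin n → EuclideanSpace ℂ (Fin m))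
    (hw : Submodule.span ℂ (Set.range w) = ⊤) {c : Fin n → ℝ} (hc : Antitone c) :
    ∃ e : Fin m → Fin n, Function.Injective e ∧ Submodule.span ℂ (Set.range (w ∘ e)) = ⊤ ∧
      ∃ o : OrthonormalBasis (Fin m) ℂ (EuclideanSpace ℂ (Fin m)),
        ∀ i, c i * ‖w i‖ ^ 2 ≤ ∑ k, c (e k) * ‖inner ℂ (o k) (w i)‖ ^ 2 := by
  classical
  set S : Set (Fin n) := {i | gramSchmidtNormed ℂ w i ≠ 0} with hS
  have hon : Orthonormal ℂ fun i : S => gramSchmidtNormed ℂ w i :=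
    gramSchmidtNormed_orthonormal' w
  have hspan : ⊤ ≤ Submodule.span ℂ (Set.range fun i : S => gramSchmidtNormed ℂ w i) := by
    rw [← hw, ← span_gramSchmidt ℂ w, ← span_gramSchmidtNormed_range w, Submodule.span_le]
    rintro _ ⟨i, rfl⟩
    by_cases hi : gramSchmidtNormed ℂ w i = 0
    · rw [hi]; exact Submodule.zero_mem _
    · exact Submodule.subset_span ⟨⟨i, hi⟩, rfl⟩
  set b := OrthonormalBasis.mk hon hspan with hb
  have hcard : Fintype.card S = Fintype.card (Fin m) := by
    rw [← Module.finrank_eq_card_basis b.toBasis, finrank_euclideanSpace]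
  obtain ⟨τ⟩ := Fintype.card_eq.mp hcard
  refine ⟨fun k => (τ.symm k : Fin n), Subtype.val_injective.comp τ.symm.injective, ?_,
    b.reindex τ, fun i => ?_⟩
  · have hmem : ∀ i, w i ∈ Submodule.span ℂ (Set.range (w ∘ fun k => (τ.symm k : Fin n))) := by
      intro i
      induction i using WellFoundedLT.induction with
      | ind i ih =>
        by_cases hi : gramSchmidtNormed ℂ w i = 0
        · have h0 : gramSchmidt ℂ w i = 0 := by
            by_contra h
            have h1 : ((‖gramSchmidt ℂ w i‖ : ℂ))⁻¹ ≠ 0 := by simpa using h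
            exact (smul_ne_zero h1 h) hi
          have h1 := gramSchmidt_def' ℂ w i
          rw [h0, zero_add] at h1
          rw [h1]
          refine Submodule.sum_mem _ fun k hk => ?_
          have h2 : gramSchmidt ℂ w k ∈ Submodule.span ℂ (w '' Set.Iic k) :=
            gramSchmidt_mem_span ℂ w le_rfl
          have h3 : Submodule.span ℂ (w '' Set.Iic k) ≤
              Submodule.span ℂ (Set.range (w ∘ fun k => (τ.symm k : Fin n))) := by
            rw [Submodule.span_le]
            rintro _ ⟨l, hl, rfl⟩
            exact ih l (lt_of_le_of_lt hl (Finset.mem_Iio.mp hk))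
          have h4 := Submodule.coe_mem
            ((ℂ ∙ gramSchmidt ℂ w k).orthogonalProjectionOnto (w i))
          exact (Submodule.span_singleton_le_iff_mem _ _).mpr (h3 h2) h4
        · exact Submodule.subset_span ⟨τ ⟨i, hi⟩, by simp⟩
    rw [eq_top_iff, ← hw, Submodule.span_le]
    rintro _ ⟨i, rfl⟩
    exact hmem i
  · rw [← (b.reindex τ).sum_sq_norm_inner_right (w i), Finset.mul_sum]
    refine Finset.sum_le_sum fun k _ => ?_
    rcases le_or_gt (τ.symm k : Fin n) i with h | h
    · exact mul_le_mul_of_nonneg_right (hc h) (by positivity)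
    · have h1 : inner ℂ ((b.reindex τ) k) (w i) = 0 := by
        rw [OrthonormalBasis.reindex_apply, hb, OrthonormalBasis.coe_mk]
        simp only [gramSchmidtNormed, inner_smul_left]
        rw [gramSchmidt_inv_triangular ℂ w h, mul_zero]
      rw [h1, norm_zero, zero_pow two_ne_zero, mul_zero, mul_zero]

lemma exists_greedy_basis {m n : ℕ} (w : Fin n → EuclideanSpace ℂ (Fin m))
    (hw : Submodule.span ℂ (Set.range w) = ⊤) (c : Fin n → ℝ) :
    ∃ e : Fin m → Fin n, Function.Injective e ∧ Submodule.span ℂ (Set.range (w ∘ e)) = ⊤ ∧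
      ∃ o : OrthonormalBasis (Fin m) ℂ (EuclideanSpace ℂ (Fin m)),
        ∀ i, c i * ‖w i‖ ^ 2 ≤ ∑ k, c (e k) * ‖inner ℂ (o k) (w i)‖ ^ 2 := by
  set τ := Tuple.sort fun i => -c i with hτ
  have hc : Antitone (c ∘ τ) := fun i j hij => by
    have := Tuple.monotone_sort (fun i => -c i) hij
    simpa using this
  obtain ⟨e, he, hspan, o, ho⟩ := exists_greedy_basis_of_antitone (w ∘ τ)
    (by rw [τ.surjective.range_comp, hw]) hc
  exact ⟨τ ∘ e, τ.injective.comp he, hspan, o, fun i => by simpa using ho (τ.symm i)⟩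

lemma span_range_mulVec_eq_top_iff {m : ℕ} {ι : Type*} {B : Matrix (Fin m) (Fin m) ℂ}
    (hB : IsUnit B.det) (x : ι → Fin m → ℂ) :
    Submodule.span ℂ (Set.range fun i => WithLp.toLp 2 (B *ᵥ x i)) =
        (⊤ : Submodule ℂ (EuclideanSpace ℂ (Fin m))) ↔
      Submodule.span ℂ (Set.range x) = ⊤ := by
  set L : (Fin m → ℂ) ≃ₗ[ℂ] EuclideanSpace ℂ (Fin m) :=
    (Matrix.toLinearEquiv' B (B.invertibleOfIsUnitDet hB)).trans (WithLp.linearEquiv 2 ℂ _).symm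
    with hL
  have h1 : (Set.range fun i => WithLp.toLp 2 (B *ᵥ x i)) = L '' Set.range x := by
    rw [← Set.range_comp]
    rfl
  rw [h1]
  constructor
  · intro h
    have h2 := congrArg (Submodule.map L.symm.toLinearMap) h
    rw [Submodule.map_span, ← Set.image_comp] at h2
    simpa using h2
  · intro h
    have h2 := congrArg (Submodule.map L.toLinearMap) h
    rw [Submodule.map_span] at h2
    simpa using h2

lemma exists_basisVertices_sum_eq {m n : ℕ} {u : Fin n → Fin m → ℂ} (q : Fin m → ℝ)
    {e : Fin m → Fin n} (he : Function.Injective e)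
    (hspan : Submodule.span ℂ (Set.range (u ∘ e)) = ⊤) (σ : Equiv.Perm (Fin m)) :
    ∃ v ∈ basisVertices u q, ∀ c : Fin n → ℝ, ∑ i, v i * c i = ∑ k, c (e k) * q (σ k) := by
  set S : Finset (Fin n) := Finset.univ.map ⟨e, he⟩ with hS
  set ρ : Fin m ≃ {i // i ∈ S} :=
    (Equiv.ofInjective e he).trans (Equiv.subtypeEquivRight fun i => by simp [hS]) with hρ
  refine ⟨_, ⟨S, by simp [hS], ?_, ρ.symm.trans σ, rfl⟩, fun c => ?_⟩
  · rw [← hspan, hS, Set.range_comp]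
    congr 2
    simp
  · rw [sum_extend_mul (ρ.symm.trans σ) q c,
      ← Equiv.sum_comp σ fun k => q k * c ((ρ.symm.trans σ).symm k)]
    refine Finset.sum_congr rfl fun k _ => ?_
    have : ((ρ.symm.trans σ).symm (σ k) : Fin n) = e k := by simp [hρ]
    rw [this, mul_comm]

lemma span_eq_top_of_approxIso {m n : ℕ} {u : Fin n → Fin m → ℂ} {p : Fin n → ℝ}
    {q : Fin m → ℝ} (hqa : Antitone q) (hq0 : ∀ i, 0 < q i) {U : Matrix (Fin m) (Fin m) ℂ}
    (hU : U ∈ Matrix.unitaryGroup (Fin m) ℂ)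
    (h : approxIso u p (U * Matrix.diagonal (fun i => (q i : ℂ)) * Uᴴ)) :
    Submodule.span ℂ (Set.range u) = ⊤ := by
  obtain ⟨t, ht0, ht⟩ : ∃ t, 0 < t ∧ ∀ l, t ≤ q l := by
    cases m with
    | zero => exact ⟨1, one_pos, fun l => l.elim0⟩
    | succ k => exact ⟨q (Fin.last k), hq0 _, fun l => hqa (Fin.le_last l)⟩
  obtain ⟨B, hB, hfrob⟩ := h (t / 2) (by positivity)
  change frob (frameOp p (fun i => B *ᵥ u i) - _) ≤ _ at hfrob
  rw [← span_range_mulVec_eq_top_iff hB]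
  by_contra hne
  obtain ⟨y, hy, hy0⟩ := Submodule.exists_mem_ne_zero_of_ne_bot
    (mt Submodule.orthogonal_eq_bot_iff.mp hne)
  have h1 : (star y.ofLp ⬝ᵥ frameOp p (fun i => B *ᵥ u i) *ᵥ y.ofLp).re = 0 := by
    rw [re_quadForm_frameOp]
    refine Finset.sum_eq_zero fun i _ => ?_
    have := normSq_star_dotProduct y (WithLp.toLp 2 (B *ᵥ u i))
    have hi : WithLp.toLp 2 (B *ᵥ u i) ∈
        Submodule.span ℂ (Set.range fun i => WithLp.toLp 2 (B *ᵥ u i)) :=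
      Submodule.subset_span (Set.mem_range_self i)
    rw [Submodule.inner_left_of_mem_orthogonal hi hy] at this
    simp only [norm_zero] at this
    rw [this]
    ring
  have h2 : t * sqNorm y.ofLp ≤
      (star y.ofLp ⬝ᵥ (U * Matrix.diagonal (fun i => (q i : ℂ)) * Uᴴ) *ᵥ y.ofLp).re := by
    have hU' : Uᴴ ∈ Matrix.unitaryGroup (Fin m) ℂ := Unitary.star_mem hU
    rw [re_quadForm_conj_diagonal, ← sqNorm_unitary_mulVec hU', sqNorm,
      Finset.mul_sum]
    exact Finset.sum_le_sum fun l _ => mul_le_mul_of_nonneg_right (ht l) (Complex.normSq_nonneg _)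
  have h3 := abs_re_quadForm_le (frameOp p (fun i => B *ᵥ u i) -
    U * Matrix.diagonal (fun i => (q i : ℂ)) * Uᴴ) y.ofLp
  rw [sub_mulVec, dotProduct_sub, Complex.sub_re, h1, zero_sub, abs_neg] at h3
  have h4 : 0 < sqNorm y.ofLp := by
    rw [sqNorm_eq_norm_sq]
    positivity
  nlinarith [le_abs_self
    (star y.ofLp ⬝ᵥ (U * Matrix.diagonal (fun i => (q i : ℂ)) * Uᴴ) *ᵥ y.ofLp).re]

/-- A linear functional bounded by `t` on the basis vertices is bounded by `t`, up to the
approximation error, at any weights `p` whose frame operator is close to `U diag(q) U†`. -/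
lemma sum_mul_le_of_frob_le {m n : ℕ} {u : Fin n → Fin m → ℂ} (hu : ∀ i, u i ≠ 0)
    (hspan : Submodule.span ℂ (Set.range u) = ⊤)
    {p : Fin n → ℝ} (hp : ∀ i, 0 ≤ p i) {q : Fin m → ℝ} {U : Matrix (Fin m) (Fin m) ℂ}
    (hU : U ∈ Matrix.unitaryGroup (Fin m) ℂ) {B : Matrix (Fin m) (Fin m) ℂ} (hB : IsUnit B.det)
    {ε : ℝ} (hfrob : frob (frameOp p (fun i => B *ᵥ u i) -
      U * Matrix.diagonal (fun i => (q i : ℂ)) * Uᴴ) ≤ ε)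
    {c : Fin n → ℝ} {t : ℝ} (ht : ∀ v ∈ basisVertices u q, ∑ i, v i * c i ≤ t) :
    ∑ i, p i * c i ≤ t + ε * ∑ i, |c i| := by
  set w : Fin n → Fin m → ℂ := fun i => B *ᵥ u i with hw
  obtain ⟨e, he, hspan', o, ho⟩ := exists_greedy_basis (fun i => WithLp.toLp 2 (w i))
    ((span_range_mulVec_eq_top_iff hB u).mpr hspan) c
  have hue : Submodule.span ℂ (Set.range (u ∘ e)) = ⊤ :=
    (span_range_mulVec_eq_top_iff hB (u ∘ e)).mp hspan'
  set N := frameOp p w with hN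
  set Q := U * Matrix.diagonal (fun i => (q i : ℂ)) * Uᴴ with hQ
  have hε : 0 ≤ ε := (Real.sqrt_nonneg _).trans hfrob
  have h1 : ∑ i, p i * c i ≤ ∑ k, c (e k) * (star (o k).ofLp ⬝ᵥ N *ᵥ (o k).ofLp).re := by
    simp only [hN, re_quadForm_frameOp, Finset.mul_sum]
    rw [Finset.sum_comm]
    refine Finset.sum_le_sum fun i _ => ?_
    have hwi : 0 < sqNorm (w i) := sqNorm_pos (mulVec_ne_zero_of_isUnit_det hB (hu i))
    have h2 := ho i
    rw [← sqNorm_eq_norm_sq] at h2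
    calc p i * c i = p i / sqNorm (w i) * (c i * sqNorm (w i)) := by field_simp
      _ ≤ p i / sqNorm (w i) * ∑ k, c (e k) * ‖inner ℂ (o k) (WithLp.toLp 2 (w i))‖ ^ 2 :=
          mul_le_mul_of_nonneg_left h2 (div_nonneg (hp i) hwi.le)
      _ = _ := by
          rw [Finset.mul_sum]
          refine Finset.sum_congr rfl fun k _ => ?_
          rw [← normSq_star_dotProduct]
          ring
  have h2 : ∑ k, c (e k) * (star (o k).ofLp ⬝ᵥ Q *ᵥ (o k).ofLp).re ≤ t := by
    simp only [hQ, re_quadForm_conj_diagonal]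
    refine sum_mul_doublyStochastic_le
      (normSq_unitary_orthonormalBasis_mem_doublyStochastic hU o) (c ∘ e) q fun σ => ?_
    obtain ⟨v, hv, hvc⟩ := exists_basisVertices_sum_eq q he hue σ
    exact (hvc c).symm.trans_le (ht v hv)
  have h3 : ∀ k, c (e k) * (star (o k).ofLp ⬝ᵥ N *ᵥ (o k).ofLp).re ≤
      c (e k) * (star (o k).ofLp ⬝ᵥ Q *ᵥ (o k).ofLp).re + ε * |c (e k)| := by
    intro k
    have h4 := abs_re_quadForm_le (N - Q) (o k).ofLp
    rw [sub_mulVec, dotProduct_sub, Complex.sub_re, sqNorm_eq_norm_sq, o.orthonormal.1 k, one_pow,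
      mul_one] at h4
    have h5 := mul_le_mul_of_nonneg_left (h4.trans hfrob) (abs_nonneg (c (e k)))
    rw [← abs_mul, mul_sub] at h5
    linarith [le_abs_self (c (e k) * (star (o k).ofLp ⬝ᵥ N *ᵥ (o k).ofLp).re -
      c (e k) * (star (o k).ofLp ⬝ᵥ Q *ᵥ (o k).ofLp).re)]
  have h4 : ∑ k, |c (e k)| ≤ ∑ i, |c i| := by
    refine (Finset.sum_map Finset.univ ⟨e, he⟩ fun i => |c i|).symm.trans_le ?_
    exact Finset.sum_le_sum_of_subset_of_nonneg (Finset.subset_univ _) fun _ _ _ => abs_nonneg _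
  calc ∑ i, p i * c i ≤ _ := h1
    _ ≤ ∑ k, (c (e k) * (star (o k).ofLp ⬝ᵥ Q *ᵥ (o k).ofLp).re + ε * |c (e k)|) :=
        Finset.sum_le_sum fun k _ => h3 k
    _ = ∑ k, c (e k) * (star (o k).ofLp ⬝ᵥ Q *ᵥ (o k).ofLp).re + ε * ∑ k, |c (e k)| := by
        rw [Finset.sum_add_distrib, Finset.mul_sum]
    _ ≤ t + ε * ∑ i, |c i| := add_le_add h2 (mul_le_mul_of_nonneg_left h4 hε)

lemma finite_basisVertices {m n : ℕ} (u : Fin n → Fin m → ℂ) (q : Fin m → ℝ) :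
    (basisVertices u q).Finite := by
  classical
  refine (Set.finite_range fun s : Σ S : Finset (Fin n), {i // i ∈ S} ≃ Fin m =>
    fun i => if h : i ∈ s.1 then q (s.2 ⟨i, h⟩) else 0).subset ?_
  rintro v ⟨S, -, -, σ, rfl⟩
  exact ⟨⟨S, σ⟩, rfl⟩

lemma mem_convexHull_of_approxIso {m n : ℕ} {u : Fin n → Fin m → ℂ} (hu : ∀ i, u i ≠ 0)
    {p : Fin n → ℝ} (hp : ∀ i, 0 ≤ p i) {q : Fin m → ℝ} (hqa : Antitone q) (hq0 : ∀ i, 0 < q i)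
    {U : Matrix (Fin m) (Fin m) ℂ} (hU : U ∈ Matrix.unitaryGroup (Fin m) ℂ)
    (h : approxIso u p (U * Matrix.diagonal (fun i => (q i : ℂ)) * Uᴴ)) :
    p ∈ convexHull ℝ (basisVertices u q) := by
  by_contra hp'
  obtain ⟨f, t, hft, htp⟩ := geometric_hahn_banach_closed_point
    (convex_convexHull ℝ (basisVertices u q))
    ((finite_basisVertices u q).isClosed_convexHull ℝ) hp'
  set c : Fin n → ℝ := fun i => f fun j => if i = j then 1 else 0 with hc
  have hfc : ∀ v, f v = ∑ i, v i * c i := fun v => by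
    simpa using LinearMap.pi_apply_eq_sum_univ (f : (Fin n → ℝ) →ₗ[ℝ] ℝ) v
  have hsum : 0 ≤ ∑ i, |c i| := Finset.sum_nonneg fun _ _ => abs_nonneg _
  have hpos : 0 < f p - t := sub_pos.mpr htp
  obtain ⟨B, hB, hfrob⟩ := h ((f p - t) / (∑ i, |c i| + 1)) (by positivity)
  have h1 := sum_mul_le_of_frob_le hu (span_eq_top_of_approxIso hqa hq0 hU h) hp hU hB hfrob
    (c := c) (t := t) fun v hv => by
      rw [← hfc]
      exact (hft v (subset_convexHull ℝ _ hv)).le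
  rw [← hfc] at h1
  have h2 : (f p - t) / (∑ i, |c i| + 1) * (∑ i, |c i| + 1) = f p - t := by field_simp
  have h3 : 0 < (f p - t) / (∑ i, |c i| + 1) := by positivity
  linarith

/-- Theorem (generalized Barthe): `(u_1,…,u_n)` can be approximately put in `Q`-isotropic
position with respect to `p` iff `p ∈ K_q(U)`, the convex hull of the vectors obtained by
placing the eigenvalues `q_1,…,q_m` of `Q` (in some order) on the indices of a basis
`{u_i : i ∈ S}` and `0` elsewhere. -/
theorem stmt18 {m n : ℕ} (u : Fin n → Fin m → ℂ) (hu : ∀ i, u i ≠ 0)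
    (p : Fin n → ℝ) (hp : ∀ i, 0 ≤ p i)
    (q : Fin m → ℝ) (hqa : Antitone q) (hq0 : ∀ i, 0 < q i)
    (Q : Matrix (Fin m) (Fin m) ℂ)
    (hQ : ∃ U ∈ Matrix.unitaryGroup (Fin m) ℂ,
      Q = U * Matrix.diagonal (fun i => (q i : ℂ)) * Uᴴ) :
    approxIso u p Q ↔
      p ∈ convexHull ℝ { v : Fin n → ℝ | ∃ S : Finset (Fin n), S.card = m ∧
        Submodule.span ℂ (u '' (S : Set (Fin n))) = ⊤ ∧
        ∃ σ : {i // i ∈ S} ≃ Fin m,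
          v = fun i => if h : i ∈ S then q (σ ⟨i, h⟩) else 0 } := by
  obtain ⟨U, hU, rfl⟩ := hQ
  exact ⟨mem_convexHull_of_approxIso hu hp hqa hq0 hU,
    approxIso_of_mem_convexHull hu hp hqa (fun i => (hq0 i).le) hU⟩
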